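/- If x* is a strict local-nonglobal minimizer of (GTRE) or of (GTR), and μ* ∈ ℝ is a Lagrangian multiplier satisfying (A₀x* + b₀) + μ*(A₁x* + b₁) = 0, then the matrix A₀ + μ*A₁ is nonsingular. -/

import Mathlib

open Matrix Finset

/-- Euclidean norm of a vector in `Fin n → ℝ`. -/
noncomputable def euclNorm {n : ℕ} (x : Fin n → ℝ) : ℝ := Real.sqrt (x ⬝ᵥ x)

/-- Objective `f₀(x) = xᵀA₀x + 2b₀ᵀx`. -/
noncomputable def qf0 {n : ℕ} (A0 : Matrix (Fin n) (Fin n) ℝ) (b0 : Fin n → ℝ)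
    (x : Fin n → ℝ) : ℝ := x ⬝ᵥ A0.mulVec x + 2 * (b0 ⬝ᵥ x)

/-- Constraint `f₁(x) = xᵀA₁x + 2b₁ᵀx + c₁`. -/
noncomputable def qf1 {n : ℕ} (A1 : Matrix (Fin n) (Fin n) ℝ) (b1 : Fin n → ℝ) (c1 : ℝ)
    (x : Fin n → ℝ) : ℝ := x ⬝ᵥ A1.mulVec x + 2 * (b1 ⬝ᵥ x) + c1

/-- Local minimizer of (GTRE): feasible, and locally optimal among feasible points. -/
def IsLocalMinGTRE {n : ℕ} (A0 A1 : Matrix (Fin n) (Fin n) ℝ) (b0 b1 : Fin n → ℝ) (c1 : ℝ)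
    (xs : Fin n → ℝ) : Prop :=
  qf1 A1 b1 c1 xs = 0 ∧ ∃ δ > (0:ℝ), ∀ x : Fin n → ℝ,
    qf1 A1 b1 c1 x = 0 → euclNorm (x - xs) < δ → qf0 A0 b0 xs ≤ qf0 A0 b0 x

/-- Global minimizer of (GTRE). -/
def IsGlobalMinGTRE {n : ℕ} (A0 A1 : Matrix (Fin n) (Fin n) ℝ) (b0 b1 : Fin n → ℝ) (c1 : ℝ)
    (xs : Fin n → ℝ) : Prop :=
  qf1 A1 b1 c1 xs = 0 ∧ ∀ x : Fin n → ℝ, qf1 A1 b1 c1 x = 0 → qf0 A0 b0 xs ≤ qf0 A0 b0 x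

/-- Local-nonglobal minimizer of (GTRE). -/
def IsLNGMinGTRE {n : ℕ} (A0 A1 : Matrix (Fin n) (Fin n) ℝ) (b0 b1 : Fin n → ℝ) (c1 : ℝ)
    (xs : Fin n → ℝ) : Prop :=
  IsLocalMinGTRE A0 A1 b0 b1 c1 xs ∧ ¬ IsGlobalMinGTRE A0 A1 b0 b1 c1 xs

/-- Strict local minimizer of (GTRE). -/
def IsStrictLocalMinGTRE {n : ℕ} (A0 A1 : Matrix (Fin n) (Fin n) ℝ) (b0 b1 : Fin n → ℝ)
    (c1 : ℝ) (xs : Fin n → ℝ) : Prop :=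
  qf1 A1 b1 c1 xs = 0 ∧ ∃ δ > (0:ℝ), ∀ x : Fin n → ℝ,
    qf1 A1 b1 c1 x = 0 → x ≠ xs → euclNorm (x - xs) < δ → qf0 A0 b0 xs < qf0 A0 b0 x

/-- Strict local-nonglobal minimizer of (GTRE). -/
def IsStrictLNGMinGTRE {n : ℕ} (A0 A1 : Matrix (Fin n) (Fin n) ℝ) (b0 b1 : Fin n → ℝ)
    (c1 : ℝ) (xs : Fin n → ℝ) : Prop :=
  IsStrictLocalMinGTRE A0 A1 b0 b1 c1 xs ∧ ¬ IsGlobalMinGTRE A0 A1 b0 b1 c1 xs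

/-- Local minimizer of (GTR). -/
def IsLocalMinGTR {n : ℕ} (A0 A1 : Matrix (Fin n) (Fin n) ℝ) (b0 b1 : Fin n → ℝ) (c1 : ℝ)
    (xs : Fin n → ℝ) : Prop :=
  qf1 A1 b1 c1 xs ≤ 0 ∧ ∃ δ > (0:ℝ), ∀ x : Fin n → ℝ,
    qf1 A1 b1 c1 x ≤ 0 → euclNorm (x - xs) < δ → qf0 A0 b0 xs ≤ qf0 A0 b0 x

/-- Global minimizer of (GTR). -/
def IsGlobalMinGTR {n : ℕ} (A0 A1 : Matrix (Fin n) (Fin n) ℝ) (b0 b1 : Fin n → ℝ) (c1 : ℝ)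
    (xs : Fin n → ℝ) : Prop :=
  qf1 A1 b1 c1 xs ≤ 0 ∧ ∀ x : Fin n → ℝ, qf1 A1 b1 c1 x ≤ 0 → qf0 A0 b0 xs ≤ qf0 A0 b0 x

/-- Local-nonglobal minimizer of (GTR). -/
def IsLNGMinGTR {n : ℕ} (A0 A1 : Matrix (Fin n) (Fin n) ℝ) (b0 b1 : Fin n → ℝ) (c1 : ℝ)
    (xs : Fin n → ℝ) : Prop :=
  IsLocalMinGTR A0 A1 b0 b1 c1 xs ∧ ¬ IsGlobalMinGTR A0 A1 b0 b1 c1 xs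

/-- Strict local minimizer of (GTR). -/
def IsStrictLocalMinGTR {n : ℕ} (A0 A1 : Matrix (Fin n) (Fin n) ℝ) (b0 b1 : Fin n → ℝ)
    (c1 : ℝ) (xs : Fin n → ℝ) : Prop :=
  qf1 A1 b1 c1 xs ≤ 0 ∧ ∃ δ > (0:ℝ), ∀ x : Fin n → ℝ,
    qf1 A1 b1 c1 x ≤ 0 → x ≠ xs → euclNorm (x - xs) < δ → qf0 A0 b0 xs < qf0 A0 b0 x

/-- Strict local-nonglobal minimizer of (GTR). -/
def IsStrictLNGMinGTR {n : ℕ} (A0 A1 : Matrix (Fin n) (Fin n) ℝ) (b0 b1 : Fin n → ℝ)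
    (c1 : ℝ) (xs : Fin n → ℝ) : Prop :=
  IsStrictLocalMinGTR A0 A1 b0 b1 c1 xs ∧ ¬ IsGlobalMinGTR A0 A1 b0 b1 c1 xs

open Filter Topology

lemma qf0_eq_qf1 {n : ℕ} (A : Matrix (Fin n) (Fin n) ℝ) (b x : Fin n → ℝ) :
    qf0 A b x = qf1 A b 0 x := by
  simp [qf0, qf1]

lemma dotProduct_self_pos {n : ℕ} {x : Fin n → ℝ} (hx : x ≠ 0) : 0 < x ⬝ᵥ x :=
  (Finset.sum_nonneg fun i _ => mul_self_nonneg (x i)).lt_of_ne'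
    (dotProduct_self_eq_zero.not.2 hx)

lemma dotProduct_mulVec_comm_of_isSymm {n : ℕ} {A : Matrix (Fin n) (Fin n) ℝ} (hA : A.IsSymm)
    (x y : Fin n → ℝ) : x ⬝ᵥ A.mulVec y = y ⬝ᵥ A.mulVec x := by
  rw [dotProduct_mulVec, ← mulVec_transpose, hA.eq, dotProduct_comm]

lemma qf1_add {n : ℕ} {A : Matrix (Fin n) (Fin n) ℝ} (hA : A.IsSymm) (b : Fin n → ℝ) (c : ℝ)
    (x y : Fin n → ℝ) :
    qf1 A b c (x + y) = qf1 A b c x + 2 * ((A.mulVec x + b) ⬝ᵥ y) + y ⬝ᵥ A.mulVec y := by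
  have h := dotProduct_mulVec_comm_of_isSymm hA x y
  have h' := dotProduct_comm (A.mulVec x) y
  simp only [qf1, mulVec_add, add_dotProduct, dotProduct_add]
  rw [h, h']
  ring

lemma qf1_add_smul {n : ℕ} {A : Matrix (Fin n) (Fin n) ℝ} (hA : A.IsSymm) (b : Fin n → ℝ) (c : ℝ)
    (x y : Fin n → ℝ) (t : ℝ) :
    qf1 A b c (x + t • y) =
      qf1 A b c x + 2 * t * ((A.mulVec x + b) ⬝ᵥ y) + t ^ 2 * (y ⬝ᵥ A.mulVec y) := by
  rw [qf1_add hA]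
  simp only [mulVec_smul, dotProduct_smul, smul_dotProduct, smul_eq_mul]
  ring

lemma qf0_add_smul {n : ℕ} {A : Matrix (Fin n) (Fin n) ℝ} (hA : A.IsSymm) (b : Fin n → ℝ)
    (x y : Fin n → ℝ) (t : ℝ) :
    qf0 A b (x + t • y) =
      qf0 A b x + 2 * t * ((A.mulVec x + b) ⬝ᵥ y) + t ^ 2 * (y ⬝ᵥ A.mulVec y) := by
  simp only [qf0_eq_qf1, qf1_add_smul hA]

lemma continuous_dotProduct_mulVec {n : ℕ} (A : Matrix (Fin n) (Fin n) ℝ) :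
    Continuous fun x : Fin n → ℝ => x ⬝ᵥ A.mulVec x :=
  continuous_id.dotProduct (continuous_const.matrix_mulVec continuous_id)

lemma continuous_qf1 {n : ℕ} (A : Matrix (Fin n) (Fin n) ℝ) (b : Fin n → ℝ) (c : ℝ) :
    Continuous (qf1 A b c) := by
  have h : Continuous fun x : Fin n → ℝ => b ⬝ᵥ x := continuous_const.dotProduct continuous_id
  exact ((continuous_dotProduct_mulVec A).add (continuous_const.mul h)).add continuous_const

lemma eventually_euclNorm_lt {n : ℕ} {δ : ℝ} (hδ : 0 < δ) :
    ∀ᶠ y : Fin n → ℝ in 𝓝 0, euclNorm y < δ := by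
  have h : Continuous fun y : Fin n → ℝ => euclNorm y :=
    Real.continuous_sqrt.comp (continuous_id.dotProduct continuous_id)
  exact h.continuousAt.eventually_lt_const (by simpa [euclNorm] using hδ)

lemma tendsto_smul_nhdsGT_zero {n : ℕ} (z : Fin n → ℝ) :
    Tendsto (fun t : ℝ => t • z) (𝓝[>] 0) (𝓝 0) := by
  have h : Continuous fun t : ℝ => t • z := by fun_prop
  simpa using (h.tendsto 0).mono_left nhdsWithin_le_nhds

/-- Displacement form of strict local minimality on the set of points whose constraint value
satisfies `P`. -/
lemma eventually_qf0_lt {n : ℕ} {A0 A1 : Matrix (Fin n) (Fin n) ℝ} {b0 b1 : Fin n → ℝ} {c1 : ℝ}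
    {xs : Fin n → ℝ} {P : ℝ → Prop}
    (h : ∃ δ > (0 : ℝ), ∀ x : Fin n → ℝ, P (qf1 A1 b1 c1 x) → x ≠ xs →
      euclNorm (x - xs) < δ → qf0 A0 b0 xs < qf0 A0 b0 x) :
    ∀ᶠ y : Fin n → ℝ in 𝓝 0, P (qf1 A1 b1 c1 (xs + y)) → y ≠ 0 →
      qf0 A0 b0 xs < qf0 A0 b0 (xs + y) := by
  obtain ⟨δ, hδ, h⟩ := h
  filter_upwards [eventually_euclNorm_lt hδ] with y hy hP hy0
  exact h _ hP (by simpa using hy0) (by simpa using hy)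

/-- In the plane spanned by `u` and `v`, with the constraint gradient nonzero along `u`, there are
feasible points of (GTRE) arbitrarily close to a given one. -/
lemma exists_qf1_eq_zero_in_plane {n : ℕ} {A : Matrix (Fin n) (Fin n) ℝ} (hA : A.IsSymm)
    {b : Fin n → ℝ} {c : ℝ} {x : Fin n → ℝ} (hx : qf1 A b c x = 0) {u : Fin n → ℝ}
    (v : Fin n → ℝ) (hu : 0 < (A.mulVec x + b) ⬝ᵥ u) {ε : ℝ} (hε : 0 < ε) :
    ∃ s t : ℝ, (s ≠ 0 ∨ t ≠ 0) ∧ ‖s • u + t • v‖ < ε ∧ qf1 A b c (x + (s • u + t • v)) = 0 := by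
  set η := (A.mulVec x + b) ⬝ᵥ u
  set γ := u ⬝ᵥ A.mulVec u
  have h1 : ∀ᶠ r : ℝ in 𝓝[>] 0, r * |γ| < 2 * η :=
    ((continuous_id.mul continuous_const).continuousAt.eventually_lt_const
      (by simpa using hu)).filter_mono nhdsWithin_le_nhds
  have h2 : ∀ᶠ r : ℝ in 𝓝[>] 0, r * (‖u‖ + ‖v‖) < ε :=
    ((continuous_id.mul continuous_const).continuousAt.eventually_lt_const
      (by simpa using hε)).filter_mono nhdsWithin_le_nhds
  obtain ⟨r, hr1, hr2, hr⟩ := (h1.and (h2.and self_mem_nhdsWithin)).exists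
  replace hr : 0 < r := hr
  let y : ℝ → Fin n → ℝ := fun θ => (r * Real.sin θ) • u + (r * Real.cos θ) • v
  have hcont : Continuous fun θ => qf1 A b c (x + y θ) :=
    (continuous_qf1 A b c).comp (by fun_prop)
  have hle : -(Real.pi / 2) ≤ Real.pi / 2 := by linarith [Real.pi_pos]
  have hneg : qf1 A b c (x + y (-(Real.pi / 2))) ≤ 0 := by
    have : y (-(Real.pi / 2)) = (-r) • u := by simp [y]
    rw [this, qf1_add_smul hA, hx]
    change 0 + 2 * -r * η + (-r) ^ 2 * γ ≤ 0
    nlinarith [mul_le_mul_of_nonneg_left (le_abs_self γ) hr.le]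
  have hpos : 0 ≤ qf1 A b c (x + y (Real.pi / 2)) := by
    have : y (Real.pi / 2) = r • u := by simp [y]
    rw [this, qf1_add_smul hA, hx]
    change 0 ≤ 0 + 2 * r * η + r ^ 2 * γ
    nlinarith [mul_le_mul_of_nonneg_left (neg_abs_le γ) hr.le]
  obtain ⟨θ, -, hθ⟩ := intermediate_value_Icc hle hcont.continuousOn ⟨hneg, hpos⟩
  refine ⟨r * Real.sin θ, r * Real.cos θ, ?_, ?_, hθ⟩
  · by_contra! h
    have hs : Real.sin θ = 0 := (mul_eq_zero.1 h.1).resolve_left hr.ne'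
    have hc : Real.cos θ = 0 := (mul_eq_zero.1 h.2).resolve_left hr.ne'
    simpa [hs, hc] using Real.sin_sq_add_cos_sq θ
  · have hs := mul_le_mul_of_nonneg_left (Real.abs_sin_le_one θ) hr.le
    have hc := mul_le_mul_of_nonneg_left (Real.abs_cos_le_one θ) hr.le
    refine (norm_add_le _ _).trans_lt (lt_of_le_of_lt ?_ hr2)
    simp only [norm_smul, norm_mul, Real.norm_eq_abs, abs_of_pos hr]
    nlinarith [norm_nonneg u, norm_nonneg v]

/-- A direction of negative curvature can be perturbed to have positive slope along `q ≠ 0`. -/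
lemma exists_neg_curvature_pos_slope {n : ℕ} (H : Matrix (Fin n) (Fin n) ℝ) {q z : Fin n → ℝ}
    (hq : q ≠ 0) (hz : z ⬝ᵥ H.mulVec z < 0) :
    ∃ u, u ⬝ᵥ H.mulVec u < 0 ∧ 0 < q ⬝ᵥ u := by
  rcases lt_or_ge (q ⬝ᵥ z) 0 with h | h
  · exact ⟨-z, by simpa [mulVec_neg] using hz, by simpa using h⟩
  · have hc : Continuous fun t : ℝ => (z + t • q) ⬝ᵥ H.mulVec (z + t • q) :=
      (continuous_dotProduct_mulVec H).comp (by fun_prop)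
    have hev := (hc.continuousAt (x := 0)).eventually_lt_const (u := 0) (by simpa using hz)
    obtain ⟨t, ht, ht0⟩ :=
      ((hev.filter_mono (nhdsWithin_le_nhds (s := Set.Ioi 0))).and self_mem_nhdsWithin).exists
    replace ht0 : 0 < t := ht0
    have hqq := dotProduct_self_pos hq
    refine ⟨z + t • q, ht, ?_⟩
    simp only [dotProduct_add, dotProduct_smul, smul_eq_mul]
    positivity

/-- The Lagrangian identity at a stationary point. -/
lemma qf0_add_of_stationary {n : ℕ} {A0 A1 : Matrix (Fin n) (Fin n) ℝ} (hA0 : A0.IsSymm)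
    (hA1 : A1.IsSymm) {b0 b1 : Fin n → ℝ} (c1 : ℝ) {xs : Fin n → ℝ} {μ : ℝ}
    (hstat : (A0.mulVec xs + b0) + μ • (A1.mulVec xs + b1) = 0) (y : Fin n → ℝ) :
    qf0 A0 b0 (xs + y) = qf0 A0 b0 xs + y ⬝ᵥ (A0 + μ • A1).mulVec y
      - μ * (qf1 A1 b1 c1 (xs + y) - qf1 A1 b1 c1 xs) := by
  rw [qf0_eq_qf1, qf0_eq_qf1, qf1_add hA0, qf1_add hA1, eq_neg_of_add_eq_zero_left hstat]
  simp only [add_mulVec, smul_mulVec, dotProduct_add, dotProduct_smul, neg_dotProduct,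
    smul_dotProduct, smul_eq_mul]
  ring

/-- At a strict local minimizer of (GTRE) with nonzero constraint gradient, if the Lagrangian has
a direction of negative curvature then its Hessian is nonsingular. -/
lemma det_ne_zero_of_neg_curvature {n : ℕ} {A0 A1 : Matrix (Fin n) (Fin n) ℝ} (hA0 : A0.IsSymm)
    (hA1 : A1.IsSymm) {b0 b1 : Fin n → ℝ} {c1 : ℝ} {xs : Fin n → ℝ} {μ : ℝ}
    (hstat : (A0.mulVec xs + b0) + μ • (A1.mulVec xs + b1) = 0) (hxs : qf1 A1 b1 c1 xs = 0)
    (hloc : ∀ᶠ y : Fin n → ℝ in 𝓝 0, qf1 A1 b1 c1 (xs + y) = 0 → y ≠ 0 →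
      qf0 A0 b0 xs < qf0 A0 b0 (xs + y))
    (hq : A1.mulVec xs + b1 ≠ 0) {z : Fin n → ℝ} (hz : z ⬝ᵥ (A0 + μ • A1).mulVec z < 0) :
    (A0 + μ • A1).det ≠ 0 := by
  intro hdet
  obtain ⟨v, hv0, hv⟩ := exists_mulVec_eq_zero_iff.2 hdet
  obtain ⟨u, hu, hqu⟩ := exists_neg_curvature_pos_slope _ hq hz
  obtain ⟨ε, hε, hball⟩ := Metric.eventually_nhds_iff.1 hloc
  obtain ⟨s, t, hst, hnorm, hfeas⟩ := exists_qf1_eq_zero_in_plane hA1 hxs v hqu hε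
  have hH : (A0 + μ • A1).IsSymm := hA0.add (hA1.smul μ)
  have hcurv : (s • u + t • v) ⬝ᵥ (A0 + μ • A1).mulVec (s • u + t • v) =
      s ^ 2 * (u ⬝ᵥ (A0 + μ • A1).mulVec u) := by
    have h := dotProduct_mulVec_comm_of_isSymm hH v u
    rw [hv, dotProduct_zero] at h
    rw [mulVec_add, mulVec_smul, mulVec_smul, hv]
    simp only [smul_zero, add_zero, add_dotProduct, dotProduct_smul, smul_dotProduct, h,
      smul_eq_mul]
    ring
  have hy0 : s • u + t • v ≠ 0 := by
    intro h
    rw [h] at hcurv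
    have hs : s = 0 := by simpa [hu.ne] using hcurv
    subst hs
    exact hst.elim (fun h => h rfl) fun ht => by simp [ht, hv0] at h
  have hlt := hball (by simpa using hnorm) hfeas hy0
  rw [qf0_add_of_stationary hA0 hA1 c1 hstat, hfeas, hxs, hcurv] at hlt
  nlinarith [sq_nonneg s]

/-- If both gradients vanish at a strict local minimizer with active constraint, scaling
displacements shows that it is a global minimizer. -/
lemma qf0_le_of_gradient_eq_zero {n : ℕ} {A0 A1 : Matrix (Fin n) (Fin n) ℝ} (hA0 : A0.IsSymm)
    (hA1 : A1.IsSymm) {b0 b1 : Fin n → ℝ} {c1 : ℝ} {xs : Fin n → ℝ} {P : ℝ → Prop}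
    (hP : ∀ a t : ℝ, P a → P (t ^ 2 * a)) (hxs : qf1 A1 b1 c1 xs = 0)
    (hloc : ∀ᶠ y : Fin n → ℝ in 𝓝 0, P (qf1 A1 b1 c1 (xs + y)) → y ≠ 0 →
      qf0 A0 b0 xs < qf0 A0 b0 (xs + y))
    (hp : A0.mulVec xs + b0 = 0) (hq : A1.mulVec xs + b1 = 0) {z : Fin n → ℝ}
    (hz : P (qf1 A1 b1 c1 (xs + z))) : qf0 A0 b0 xs ≤ qf0 A0 b0 (xs + z) := by
  by_contra! hlt
  obtain ⟨t, ht, ht0⟩ :=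
    (((tendsto_smul_nhdsGT_zero z).eventually hloc).and self_mem_nhdsWithin).exists
  replace ht0 : 0 < t := ht0
  have h1 := qf1_add_smul hA1 b1 c1 xs z 1
  have h0 := qf0_add_smul hA0 b0 xs z 1
  simp only [hp, hq, hxs, zero_dotProduct, one_smul, one_pow, one_mul, mul_zero, zero_add,
    add_zero] at h0 h1
  have hz0 : z ≠ 0 := by
    rintro rfl
    simp at hlt
  have := ht (by
    rw [qf1_add_smul hA1, hq, hxs, zero_dotProduct, mul_zero, zero_add, zero_add, ← h1]
    exact hP _ _ hz) (smul_ne_zero ht0.ne' hz0)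
  rw [qf0_add_smul hA0, hp, zero_dotProduct] at this
  nlinarith [sq_nonneg t]

/-- A strict local minimizer of (GTR) with inactive constraint is a global minimizer. -/
lemma qf0_le_of_qf1_neg {n : ℕ} {A0 A1 : Matrix (Fin n) (Fin n) ℝ} (hA0 : A0.IsSymm)
    {b0 b1 : Fin n → ℝ} {c1 : ℝ} {xs : Fin n → ℝ} (hxs : qf1 A1 b1 c1 xs < 0)
    (hloc : ∀ᶠ y : Fin n → ℝ in 𝓝 0, qf1 A1 b1 c1 (xs + y) ≤ 0 → y ≠ 0 →
      qf0 A0 b0 xs < qf0 A0 b0 (xs + y)) (z : Fin n → ℝ) :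
    qf0 A0 b0 xs ≤ qf0 A0 b0 (xs + z) := by
  by_contra! hlt
  have hz0 : z ≠ 0 := by
    rintro rfl
    simp at hlt
  have hfeas : ∀ᶠ y : Fin n → ℝ in 𝓝 0, qf1 A1 b1 c1 (xs + y) < 0 :=
    ((continuous_qf1 A1 b1 c1).comp (continuous_const.add continuous_id)).continuousAt
      |>.eventually_lt_const (by simpa using hxs)
  have hmin : ∀ᶠ y : Fin n → ℝ in 𝓝 0, y ≠ 0 → qf0 A0 b0 xs < qf0 A0 b0 (xs + y) := by
    filter_upwards [hloc, hfeas] with y h h' using h h'.le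
  obtain ⟨t, hpos, hneg, ht1, ht0⟩ :=
    (((tendsto_smul_nhdsGT_zero z).eventually hmin).and
      (((tendsto_smul_nhdsGT_zero (-z)).eventually hmin).and
        (((eventually_lt_nhds (zero_lt_one' ℝ)).filter_mono nhdsWithin_le_nhds).and
          self_mem_nhdsWithin))).exists
  replace ht0 : 0 < t := ht0
  replace hpos := hpos (smul_ne_zero ht0.ne' hz0)
  replace hneg := hneg (smul_ne_zero ht0.ne' (neg_ne_zero.2 hz0))
  have h0 := qf0_add_smul hA0 b0 xs z 1
  rw [one_smul] at h0
  rw [qf0_add_smul hA0] at hpos hneg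
  simp only [dotProduct_neg, mulVec_neg, neg_dotProduct, neg_neg] at hneg
  set a := z ⬝ᵥ A0.mulVec z
  set b := (A0.mulVec xs + b0) ⬝ᵥ z
  have ha : 0 < a := by
    by_contra! ha
    nlinarith [sq_nonneg t]
  have hab : 2 * b + a < 0 := by linarith
  have : t * (2 * b + t * a) < 0 := mul_neg_of_pos_of_neg ht0 (by nlinarith)
  linarith

/-- A Lagrange multiplier at a local minimizer of (GTR) with nonzero constraint gradient is
nonnegative. -/
lemma multiplier_nonneg {n : ℕ} {A0 A1 : Matrix (Fin n) (Fin n) ℝ} (hA0 : A0.IsSymm)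
    (hA1 : A1.IsSymm) {b0 b1 : Fin n → ℝ} {c1 : ℝ} {xs : Fin n → ℝ} {μ : ℝ}
    (hstat : (A0.mulVec xs + b0) + μ • (A1.mulVec xs + b1) = 0) (hxs : qf1 A1 b1 c1 xs = 0)
    (hloc : ∀ᶠ y : Fin n → ℝ in 𝓝 0, qf1 A1 b1 c1 (xs + y) ≤ 0 → y ≠ 0 →
      qf0 A0 b0 xs < qf0 A0 b0 (xs + y))
    (hq : A1.mulVec xs + b1 ≠ 0) : 0 ≤ μ := by
  by_contra! hμ
  set q := A1.mulVec xs + b1 with hqdef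
  have hqq := dotProduct_self_pos hq
  have hsmall : ∀ a η : ℝ, 0 < η → ∀ᶠ t : ℝ in 𝓝[>] 0, t * a < η := fun a η hη =>
    ((continuous_id.mul continuous_const).continuousAt.eventually_lt_const
      (by simpa using hη)).filter_mono nhdsWithin_le_nhds
  obtain ⟨t, ht, h1, h2, ht0⟩ :=
    (((tendsto_smul_nhdsGT_zero (-q)).eventually hloc).and
      ((hsmall (q ⬝ᵥ A1.mulVec q) (2 * (q ⬝ᵥ q)) (by positivity)).and
        ((hsmall (q ⬝ᵥ A0.mulVec q) (2 * (-μ * (q ⬝ᵥ q)))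
          (mul_pos two_pos (mul_pos (neg_pos.2 hμ) hqq))).and self_mem_nhdsWithin))).exists
  replace ht0 : 0 < t := ht0
  have hp : A0.mulVec xs + b0 = -(μ • q) := eq_neg_of_add_eq_zero_left hstat
  have := ht (by
    rw [qf1_add_smul hA1, hxs, ← hqdef]
    simp only [dotProduct_neg, mulVec_neg, neg_dotProduct, neg_neg]
    nlinarith) (smul_ne_zero ht0.ne' (neg_ne_zero.2 hq))
  rw [qf0_add_smul hA0, hp] at this
  simp only [dotProduct_neg, mulVec_neg, neg_dotProduct, neg_neg, smul_dotProduct,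
    smul_eq_mul] at this
  nlinarith

theorem stmt7 {n : ℕ} (hn : 1 ≤ n)
    (A0 A1 : Matrix (Fin n) (Fin n) ℝ) (hA0 : A0.IsSymm) (hA1 : A1.IsSymm)
    (b0 b1 : Fin n → ℝ) (c1 : ℝ) (xs : Fin n → ℝ) (μ : ℝ)
    (hx : IsStrictLNGMinGTRE A0 A1 b0 b1 c1 xs ∨ IsStrictLNGMinGTR A0 A1 b0 b1 c1 xs)
    (hstat : (A0.mulVec xs + b0) + μ • (A1.mulVec xs + b1) = 0) :
    (A0 + μ • A1).det ≠ 0 := by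
  have hgrad : A1.mulVec xs + b1 = 0 → A0.mulVec xs + b0 = 0 := fun h => by simpa [h] using hstat
  rcases hx with ⟨⟨hxs, hmin⟩, hng⟩ | ⟨⟨hxs, hmin⟩, hng⟩
  · have hloc := eventually_qf0_lt (P := fun a => a = 0) hmin
    obtain ⟨x, hx1, hx0⟩ : ∃ x, qf1 A1 b1 c1 x = 0 ∧ qf0 A0 b0 x < qf0 A0 b0 xs := by
      by_contra! h
      exact hng ⟨hxs, h⟩
    obtain ⟨z, rfl⟩ : ∃ z, x = xs + z := ⟨x - xs, by simp⟩
    have hq : A1.mulVec xs + b1 ≠ 0 := fun hq => hx0.not_ge <|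
      qf0_le_of_gradient_eq_zero hA0 hA1 (P := fun a => a = 0) (by simp +contextual) hxs hloc
        (hgrad hq) hq hx1
    refine det_ne_zero_of_neg_curvature hA0 hA1 hstat hxs hloc hq (z := z) ?_
    rw [qf0_add_of_stationary hA0 hA1 c1 hstat, hx1, hxs] at hx0
    linarith
  · have hloc := eventually_qf0_lt (P := fun a => a ≤ 0) hmin
    obtain ⟨x, hx1, hx0⟩ : ∃ x, qf1 A1 b1 c1 x ≤ 0 ∧ qf0 A0 b0 x < qf0 A0 b0 xs := by
      by_contra! h
      exact hng ⟨hxs, h⟩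
    obtain ⟨z, rfl⟩ : ∃ z, x = xs + z := ⟨x - xs, by simp⟩
    replace hxs : qf1 A1 b1 c1 xs = 0 := hxs.eq_of_not_lt fun h =>
      hx0.not_ge (qf0_le_of_qf1_neg hA0 h hloc z)
    have hq : A1.mulVec xs + b1 ≠ 0 := fun hq => hx0.not_ge <|
      qf0_le_of_gradient_eq_zero hA0 hA1 (P := fun a => a ≤ 0)
        (fun a t ha => mul_nonpos_of_nonneg_of_nonpos (sq_nonneg t) ha) hxs hloc
        (hgrad hq) hq hx1
    have hμ := multiplier_nonneg hA0 hA1 hstat hxs hloc hq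
    refine det_ne_zero_of_neg_curvature hA0 hA1 hstat hxs
      (hloc.mono fun y hy h => hy h.le) hq (z := z) ?_
    rw [qf0_add_of_stationary hA0 hA1 c1 hstat, hxs] at hx0
    nlinarith [mul_nonpos_of_nonneg_of_nonpos hμ hx1]
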